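/- arXiv:1202.3422 — 2 statements merged into one kernel-verified Lean document; each statement's English description precedes it below -/
import Mathlib

section
/- Let r, s ≥ 1 be integers and let a = (a_1, …, a_r) and b = (b_1, …, b_r) be vectors of nonnegative integers satisfying 0 < σ_1(a) ≤ s and 0 < σ_1(b) ≤ s. If C is an integer such that σ_i(C, C+a) = σ_i(0, b) for all integers i with 1 ≤ i ≤ s, then C = 0 and b is a permutation of a (equivalently, a and b are equal as multisets). -/
/-- The `k`-th elementary symmetric polynomial of the tuple `v`. -/
def esymm {R : Type*} [CommSemiring R] {n : ℕ} (v : Fin n → R) (k : ℕ) : R :=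
  ∑ S ∈ Finset.powersetCard k Finset.univ, ∏ j ∈ S, v j

theorem esymm_eq_multiset_esymm {R : Type*} [CommSemiring R] {n : ℕ} (v : Fin n → R) (k : ℕ) :
    esymm v k = (Multiset.map v Finset.univ.val).esymm k :=
  (Finset.esymm_map_val v Finset.univ k).symm

theorem esymm_zero {R : Type*} [CommSemiring R] {n : ℕ} (v : Fin n → R) : esymm v 0 = 1 := by
  simp [esymm]

theorem esymm_one {R : Type*} [CommSemiring R] {n : ℕ} (v : Fin n → R) :
    esymm v 1 = ∑ i, v i := by
  simp [esymm, Finset.powersetCard_one]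

theorem esymm_eq_zero_of_lt {R : Type*} [CommSemiring R] {n : ℕ} (v : Fin n → R) {k : ℕ}
    (hk : n < k) : esymm v k = 0 := by
  rw [esymm, Finset.powersetCard_eq_empty.2 (by simpa using hk), Finset.sum_empty]

/-- A tuple of natural numbers has at most as many nonzero entries as its sum. -/
theorem esymm_natCast_eq_zero_of_sum_lt {R : Type*} [CommSemiring R] {n : ℕ} (v : Fin n → ℕ)
    {k : ℕ} (hk : ∑ i, v i < k) : esymm (fun i => (v i : R)) k = 0 := by
  refine Finset.sum_eq_zero fun S hS => ?_
  obtain ⟨j, hj, hvj⟩ : ∃ j ∈ S, v j = 0 := by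
    by_contra! hne
    have h1 : S.card • 1 ≤ ∑ i ∈ S, v i :=
      Finset.card_nsmul_le_sum _ _ _ fun i hi => Nat.one_le_iff_ne_zero.2 (hne i hi)
    have h2 : ∑ i ∈ S, v i ≤ ∑ i, v i := Finset.sum_le_sum_of_subset S.subset_univ
    have h3 := (Finset.mem_powersetCard.1 hS).2
    simp only [smul_eq_mul, mul_one] at h1
    omega
  exact Finset.prod_eq_zero hj (by simp [hvj])

/-- Over a domain, a multiset is determined by its elementary symmetric polynomials. -/
theorem Multiset.eq_of_card_eq_of_esymm_eq {R : Type*} [CommRing R] [IsDomain R]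
    {s t : Multiset R} (hcard : s.card = t.card) (h : ∀ k, s.esymm k = t.esymm k) : s = t := by
  rw [← Polynomial.roots_multiset_prod_X_sub_C s, ← Polynomial.roots_multiset_prod_X_sub_C t,
    Multiset.prod_X_sub_X_eq_sum_esymm, Multiset.prod_X_sub_X_eq_sum_esymm, hcard]
  simp only [h]

/-- Two families with the same multiset of values differ by a permutation of the indices. -/
theorem exists_perm_of_map_univ_eq {ι α : Type*} [Fintype ι] {f g : ι → α}
    (h : Multiset.map f Finset.univ.val = Multiset.map g Finset.univ.val) :
    ∃ π : Equiv.Perm ι, ∀ i, g i = f (π i) := by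
  classical
  have hcard (c : α) : Fintype.card {i // g i = c} = Fintype.card {i // f i = c} := by
    have := congrArg (Multiset.count c) h
    simp only [Multiset.count_map, ← Finset.filter_val, Finset.card_val] at this
    simp only [Fintype.card_subtype, eq_comm (b := c), this]
  exact ⟨Equiv.ofFiberEquiv fun c => Fintype.equivOfCardEq (hcard c),
    fun i => (Equiv.ofFiberEquiv_map _ i).symm⟩

theorem esymm_cons_zero_natCast_eq_zero_of_sum_lt {r k : ℕ} (v : Fin r → ℕ)
    (hk : ∑ i, v i < k) : esymm (Fin.cons (0 : ℤ) (fun j => (v j : ℤ))) k = 0 := by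
  have hv : (Fin.cons (0 : ℤ) (fun j => (v j : ℤ)) : Fin (r + 1) → ℤ) =
      fun i => (((Fin.cons 0 v : Fin (r + 1) → ℕ) i : ℕ) : ℤ) := by
    funext i
    cases i using Fin.cases <;> simp
  rw [hv]
  exact esymm_natCast_eq_zero_of_sum_lt _ (by simpa [Fin.sum_univ_succ] using hk)

/-- If `0 < σ₁(a) ≤ s`, `0 < σ₁(b) ≤ s` and `σᵢ(C, C+a) = σᵢ(0, b)` for all
`1 ≤ i ≤ s`, then `C = 0` and `b` is a permutation of `a`. -/
theorem stmt_5 (r s : ℕ) (hr : 1 ≤ r) (hs : 1 ≤ s) (a b : Fin r → ℕ)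
    (ha0 : 0 < ∑ i, a i) (has : ∑ i, a i ≤ s)
    (hb0 : 0 < ∑ i, b i) (hbs : ∑ i, b i ≤ s) (C : ℤ)
    (h : ∀ i : ℕ, 1 ≤ i → i ≤ s →
      esymm (Fin.cons C (fun j => C + (a j : ℤ))) i =
        esymm (Fin.cons (0 : ℤ) (fun j => (b j : ℤ))) i) :
    C = 0 ∧ ∃ π : Equiv.Perm (Fin r), ∀ i, b i = a (π i) := by
  have hsmall : s ≤ r → C = 0 := by
    intro hsr
    have h1 := h 1 le_rfl hs
    simp only [esymm_one, Fin.sum_univ_succ, Fin.cons_zero, Fin.cons_succ,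
      Finset.sum_add_distrib, Finset.sum_const, Finset.card_univ, Fintype.card_fin,
      nsmul_eq_mul, ← Nat.cast_sum] at h1
    have hdiv : ((r : ℤ) + 1) ∣ ((∑ i, b i : ℕ) : ℤ) - ((∑ i, a i : ℕ) : ℤ) :=
      ⟨C, by linarith⟩
    have hzero := Int.eq_zero_of_abs_lt_dvd hdiv (by rw [abs_lt]; constructor <;> omega)
    have hmul : ((r : ℤ) + 1) * C = 0 := by linarith
    exact (mul_eq_zero.1 hmul).resolve_left (by omega)
  have hall (k : ℕ) : esymm (Fin.cons C (fun j => C + (a j : ℤ))) k =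
      esymm (Fin.cons (0 : ℤ) (fun j => (b j : ℤ))) k := by
    rcases Nat.eq_zero_or_pos k with rfl | hk
    · rw [esymm_zero, esymm_zero]
    rcases le_or_gt k s with hks | hks
    · exact h k hk hks
    rw [esymm_cons_zero_natCast_eq_zero_of_sum_lt b (by omega)]
    rcases le_or_gt s r with hsr | hsr
    · simp only [hsmall hsr, zero_add]
      exact esymm_cons_zero_natCast_eq_zero_of_sum_lt a (by omega)
    · exact esymm_eq_zero_of_lt _ (by omega)
  have hmap : Multiset.map (Fin.cons C (fun j => C + (a j : ℤ)) : Fin (r + 1) → ℤ)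
      Finset.univ.val =
        Multiset.map (Fin.cons (0 : ℤ) (fun j => (b j : ℤ)) : Fin (r + 1) → ℤ)
          Finset.univ.val :=
    Multiset.eq_of_card_eq_of_esymm_eq (by simp)
      fun k => by simpa only [esymm_eq_multiset_esymm] using hall k
  obtain ⟨π, hπ⟩ := exists_perm_of_map_univ_eq hmap
  have hC : C = 0 := by
    apply le_antisymm
    · have h0 := hπ 0
      rw [Fin.cons_zero] at h0
      cases hj : π 0 using Fin.cases with
      | zero => rw [hj, Fin.cons_zero] at h0; omega
      | succ j => rw [hj, Fin.cons_succ] at h0; omega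
    · have h0 := hπ (π.symm 0)
      rw [Equiv.apply_symm_apply, Fin.cons_zero] at h0
      cases hj : π.symm 0 using Fin.cases with
      | zero => rw [hj, Fin.cons_zero] at h0; omega
      | succ j => rw [hj, Fin.cons_succ] at h0; omega
  refine ⟨hC, exists_perm_of_map_univ_eq ?_⟩
  subst hC
  apply Multiset.map_injective (Nat.cast_injective (R := ℤ))
  simpa [Fin.univ_succ, Function.comp_def] using hmap
end

section
/- Let r ≥ 1 and 1 ≤ k ≤ r be integers and let a = (0, …, 0, 1, …, 1) be the vector of length r with r − k entries equal to 0 and k entries equal to 1 (so σ_1(a) = k). If b = (b_1, …, b_r) is a vector of nonnegative integers and C is an integer such that σ_i(C, C+a) = σ_i(0, b) for i = 1 and i = 2, then C = 0 and b is a permutation of a. -/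
theorem Finset.sum_sq_eq_sum_sq_add_two_mul_sum_powersetCard {ι R : Type*} [DecidableEq ι]
    [CommSemiring R] (s : Finset ι) (v : ι → R) :
    (∑ i ∈ s, v i) ^ 2 =
      ∑ i ∈ s, v i ^ 2 + 2 * ∑ S ∈ s.powersetCard 2, ∏ j ∈ S, v j := by
  induction s using Finset.induction_on with
  | empty =>
    rw [Finset.powersetCard_eq_empty.2 (by simp)]
    simp
  | insert x s hx ih =>
    have hdisj : Disjoint (s.powersetCard 2) ((s.powersetCard 1).image (insert x)) := by
      rw [Finset.disjoint_left]
      intro S hS hS'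
      obtain ⟨T, -, rfl⟩ := Finset.mem_image.1 hS'
      exact hx ((Finset.mem_powersetCard.1 hS).1 (Finset.mem_insert_self x T))
    have himage : ∑ S ∈ (s.powersetCard 1).image (insert x), ∏ j ∈ S, v j =
        v x * ∑ i ∈ s, v i := by
      rw [Finset.sum_image, Finset.powersetCard_one, Finset.sum_map, Finset.mul_sum]
      · refine Finset.sum_congr rfl fun i hi => ?_
        have hxi : x ≠ i := fun hxi => hx (hxi ▸ hi)
        simp [Finset.prod_pair hxi]
      · intro S hS T hT hST
        have hxS : x ∉ S := fun hxS => hx ((Finset.mem_powersetCard.1 hS).1 hxS)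
        have hxT : x ∉ T := fun hxT => hx ((Finset.mem_powersetCard.1 hT).1 hxT)
        rw [← Finset.erase_insert hxS, ← Finset.erase_insert hxT]
        exact congrArg (fun U => Finset.erase U x) hST
    rw [Finset.powersetCard_succ_insert hx, Finset.sum_union hdisj, himage,
      Finset.sum_insert hx, Finset.sum_insert hx, add_sq, ih]
    ring

theorem sum_sq_add_two_mul_esymm_two {R : Type*} [CommSemiring R] {n : ℕ} (v : Fin n → R) :
    (∑ i, v i) ^ 2 = ∑ i, v i ^ 2 + 2 * esymm v 2 :=
  Finset.sum_sq_eq_sum_sq_add_two_mul_sum_powersetCard Finset.univ v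

theorem Int.mul_sub_one_nonneg (x : ℤ) : 0 ≤ x * (x - 1) := by
  rcases le_or_gt x 0 with hx | hx
  · exact mul_nonneg_of_nonpos_of_nonpos hx (by lia)
  · exact mul_nonneg hx.le (by lia)

theorem Fin.sum_ite_lt_sub {r k : ℕ} (hkr : k ≤ r) :
    ∑ i : Fin r, (if (i : ℕ) < r - k then 0 else 1) = k := by
  obtain ⟨m, rfl⟩ := Nat.exists_eq_add_of_le' hkr
  rw [Fin.sum_univ_eq_sum_range (fun i => if i < m + k - k then 0 else 1) (m + k),
    Finset.sum_range_add, Finset.sum_eq_zero]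
  · simp
  · intro i hi
    simpa using hi

/-- Two zero-one vectors with the same sum are permutations of each other. -/
theorem exists_perm_of_sum_eq {ι : Type*} [Fintype ι] {a b : ι → ℕ}
    (ha : ∀ i, a i = 0 ∨ a i = 1) (hb : ∀ i, b i = 0 ∨ b i = 1)
    (hab : ∑ i, a i = ∑ i, b i) : ∃ π : Equiv.Perm ι, ∀ i, b i = a (π i) := by
  classical
  have hcard : ∀ c : ι → ℕ, (∀ i, c i = 0 ∨ c i = 1) →
      Fintype.card {i // c i = 1} = ∑ i, c i := by
    intro c hc
    rw [Fintype.card_subtype, Finset.card_filter]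
    refine Finset.sum_congr rfl fun i _ => ?_
    rcases hc i with h | h <;> simp [h]
  let e : {i // b i = 1} ≃ {i // a i = 1} :=
    Fintype.equivOfCardEq (by rw [hcard a ha, hcard b hb, hab])
  refine ⟨e.extendSubtype, fun i => ?_⟩
  by_cases hi : b i = 1
  · rw [hi, e.extendSubtype_mem i hi]
  · have := e.extendSubtype_not_mem i hi
    rw [(hb i).resolve_right hi, (ha _).resolve_right this]

/-- Let `a` be the vector with `r − k` zeros followed by `k` ones. If `b` is a
nonnegative integer vector and `C` an integer with `σᵢ(C, C+a) = σᵢ(0, b)` for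
`i = 1, 2`, then `C = 0` and `b` is a permutation of `a`. -/
theorem stmt_14 (r k : ℕ) (hr : 1 ≤ r) (hk1 : 1 ≤ k) (hkr : k ≤ r)
    (a : Fin r → ℕ) (ha : ∀ i, a i = if (i : ℕ) < r - k then 0 else 1)
    (b : Fin r → ℕ) (C : ℤ)
    (h : ∀ i : ℕ, i = 1 ∨ i = 2 →
      esymm (Fin.cons C (fun j => C + (a j : ℤ))) i =
        esymm (Fin.cons (0 : ℤ) (fun j => (b j : ℤ))) i) :
    C = 0 ∧ ∃ π : Equiv.Perm (Fin r), ∀ i, b i = a (π i) := by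
  have ha01 : ∀ i, a i = 0 ∨ a i = 1 := fun i => by
    rw [ha i]; split_ifs <;> simp
  have hsum_a : ∑ i, a i = k := by
    simp_rw [ha]; exact Fin.sum_ite_lt_sub hkr
  have hsum_a' : ∑ i, (a i : ℤ) = k := by exact_mod_cast hsum_a
  have hsq_a : ∑ i, (a i : ℤ) ^ 2 = k := by
    rw [← hsum_a']
    refine Finset.sum_congr rfl fun i _ => ?_
    rcases ha01 i with h | h <;> simp [h]
  have h1 : (r + 1) * C + k = ∑ i, (b i : ℤ) := by
    have h1 := h 1 (Or.inl rfl)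
    simp only [esymm_one, Fin.sum_univ_succ, Fin.cons_zero, Fin.cons_succ,
      Finset.sum_add_distrib, hsum_a', Finset.sum_const, Finset.card_univ, Fintype.card_fin,
      nsmul_eq_mul] at h1
    linarith
  have h2 : (r + 1) * C ^ 2 + 2 * C * k + k = ∑ i, (b i : ℤ) ^ 2 := by
    have hl := sum_sq_add_two_mul_esymm_two (Fin.cons C (fun j => C + (a j : ℤ)))
    have hr' := sum_sq_add_two_mul_esymm_two (Fin.cons (0 : ℤ) (fun j => (b j : ℤ)))
    rw [h 2 (Or.inr rfl)] at hl
    simp only [Fin.sum_univ_succ, Fin.cons_zero, Fin.cons_succ, add_sq,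
      Finset.sum_add_distrib, hsum_a', hsq_a, ← Finset.mul_sum, Finset.sum_const,
      Finset.card_univ, Fintype.card_fin, nsmul_eq_mul, ← h1] at hl hr'
    linarith
  have hC_nonneg : 0 ≤ C := by
    have hb : 0 ≤ ∑ i, (b i : ℤ) := Finset.sum_nonneg fun i _ => Int.natCast_nonneg _
    have hkr' : (k : ℤ) ≤ r := by exact_mod_cast hkr
    by_contra! hC
    nlinarith
  have hC : C = 0 := by
    have key : 0 ≤ ∑ i, ((b i : ℤ) - C) * ((b i : ℤ) - C - 1) :=
      Finset.sum_nonneg fun i _ => Int.mul_sub_one_nonneg _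
    have expand : ∑ i, ((b i : ℤ) - C) * ((b i : ℤ) - C - 1) =
        ∑ i, (b i : ℤ) ^ 2 - (2 * C + 1) * ∑ i, (b i : ℤ) + r * (C * (C + 1)) := by
      have hterm : ∀ i, ((b i : ℤ) - C) * ((b i : ℤ) - C - 1) =
          (b i : ℤ) ^ 2 - (2 * C + 1) * (b i : ℤ) + C * (C + 1) := fun i => by ring
      simp [hterm, Finset.sum_add_distrib, Finset.mul_sum]
    rw [expand, ← h1, ← h2] at key
    nlinarith
  subst hC
  have hb01 : ∀ i, b i = 0 ∨ b i = 1 := by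
    have hzero : ∑ i, (b i : ℤ) * ((b i : ℤ) - 1) = 0 := by
      simp only [mul_sub, mul_one, ← sq, Finset.sum_sub_distrib]
      linarith
    intro i
    have hi := (Finset.sum_eq_zero_iff_of_nonneg
      fun i _ => Int.mul_sub_one_nonneg (b i : ℤ)).1 hzero i (Finset.mem_univ i)
    rcases mul_eq_zero.1 hi with hi | hi <;> lia
  refine ⟨rfl, exists_perm_of_sum_eq ha01 hb01 ?_⟩
  rw [hsum_a]
  zify
  linarith
end
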